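/- For every α ∈ [0,1] there exists a set A ⊆ ℕ possessing asymptotic density such that the sumset A + P (P the set of primes) also possesses asymptotic density and d(A + P) = α. -/

import Mathlib

open Filter Set

/-- Upper asymptotic density. -/
noncomputable def upperDensity (X : Set ℕ) : ℝ :=
  Filter.limsup (fun n : ℕ => ((X ∩ Set.Icc 1 n).ncard : ℝ) / n) Filter.atTop

/-- `A` is a finite union of arithmetic progressions `k·ℕ + h` with `k ≥ 1`. -/
def IsAPUnion (A : Set ℕ) : Prop :=
  ∃ S : Finset (ℕ × ℕ), (∀ p ∈ S, 1 ≤ p.1) ∧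
    A = ⋃ p ∈ S, {n : ℕ | ∃ m : ℕ, n = p.1 * m + p.2}

/-- Upper Buck density. -/
noncomputable def buckUpper (X : Set ℕ) : ℝ :=
  sInf {d : ℝ | ∃ A : Set ℕ, IsAPUnion A ∧ X ⊆ A ∧ d = upperDensity A}

/-- Lower Buck density. -/
noncomputable def buckLower (X : Set ℕ) : ℝ := 1 - buckUpper Xᶜ

/-- Sumset of two subsets of ℕ. -/
def sumset (X Y : Set ℕ) : Set ℕ := {n : ℕ | ∃ x ∈ X, ∃ y ∈ Y, n = x + y}

/-- An arithmetic upper quasi-density on ℕ. -/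
structure ArithUpperQuasiDensity where
  toFun : Set ℕ → ℝ
  le_one : ∀ X : Set ℕ, toFun X ≤ 1
  univ_eq : toFun Set.univ = 1
  subadd : ∀ X Y : Set ℕ, toFun (X ∪ Y) ≤ toFun X + toFun Y
  scale : ∀ (X : Set ℕ) (k h : ℕ), 1 ≤ k →
    toFun ((fun x => k * x + h) '' X) = toFun X / k

/-- Conjugate (lower) quasi-density. -/
noncomputable def ArithUpperQuasiDensity.conj (μ : ArithUpperQuasiDensity)
    (X : Set ℕ) : ℝ := 1 - μ.toFun Xᶜ

/-- `X` has asymptotic density `a`. -/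
def hasDensity (X : Set ℕ) (a : ℝ) : Prop :=
  Filter.Tendsto (fun n : ℕ => ((X ∩ Set.Icc 1 n).ncard : ℝ) / n)
    Filter.atTop (nhds a)

open scoped Pointwise

namespace Aux17

noncomputable def cnt (X : Set ℕ) (n : ℕ) : ℝ := ((X ∩ Set.Icc 1 n).ncard : ℝ)

lemma cnt_mono {X Y : Set ℕ} {n : ℕ} (h : X ∩ Set.Icc 1 n ⊆ Y) : cnt X n ≤ cnt Y n := by
  unfold cnt
  have : X ∩ Set.Icc 1 n ⊆ Y ∩ Set.Icc 1 n := fun x hx => ⟨h hx, hx.2⟩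
  exact_mod_cast Set.ncard_le_ncard this ((Set.finite_Icc 1 n).inter_of_right _)

lemma cnt_le (X : Set ℕ) (n : ℕ) : cnt X n ≤ n := by
  unfold cnt
  have : (X ∩ Set.Icc 1 n).ncard ≤ (Set.Icc 1 n).ncard :=
    Set.ncard_le_ncard Set.inter_subset_right (Set.finite_Icc 1 n)
  rw [← Finset.coe_Icc, Set.ncard_coe_finset] at this
  simp only [Nat.card_Icc, Nat.add_sub_cancel] at this
  rw [← Finset.coe_Icc]
  exact_mod_cast this

lemma cnt_tail {X Y : Set ℕ} {n M : ℕ} (h : ∀ x ∈ X, M ≤ x → x ∈ Y) : cnt X n ≤ cnt Y n + M := by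
  have h1 : X ∩ Set.Icc 1 n ⊆ (Y ∩ Set.Icc 1 n) ∪ (Finset.range M : Set ℕ) := by
    intro x hx
    by_cases hM : M ≤ x
    · exact Or.inl ⟨h x hx.1 hM, hx.2⟩
    · right; simp; omega
  have h2 := Set.ncard_le_ncard h1
    (((Set.finite_Icc 1 n).inter_of_right _).union (Finset.finite_toSet _))
  have h3 := Set.ncard_union_le (Y ∩ Set.Icc 1 n) (Finset.range M : Set ℕ)
  rw [Set.ncard_coe_finset, Finset.card_range] at h3
  unfold cnt
  exact_mod_cast h2.trans h3

lemma dens_mono {X Y : Set ℕ} {a b : ℝ} (hX : hasDensity X a) (hY : hasDensity Y b)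
    (h : X ⊆ Y) : a ≤ b := by
  refine le_of_tendsto_of_tendsto' hX hY fun n => ?_
  exact div_le_div_of_nonneg_right (cnt_mono (fun x hx => h hx.1)) (Nat.cast_nonneg n)

lemma dens_le_one {X : Set ℕ} {a : ℝ} (hX : hasDensity X a) : a ≤ 1 := by
  refine le_of_tendsto' hX fun n => ?_
  exact div_le_one_of_le₀ (cnt_le X n) (Nat.cast_nonneg n)

lemma dens_limit (S : ℕ → Set ℕ) (B : Set ℕ) (d : ℕ → ℝ) (δ : ℝ) (N : ℕ → ℕ)
    (hN : StrictMono N) (hd : Tendsto d atTop (nhds δ)) (hle : ∀ k, d k ≤ δ)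
    (hS : ∀ k, hasDensity (S k) (d k))
    (hup : ∀ k n, N k ≤ n → cnt (S k) n / n ≤ d k + 1 / ((k : ℝ) + 1))
    (h1 : ∀ k x, x ∈ B → x < N (k + 1) → x ∈ S k)
    (h2 : ∀ k, ∃ M, ∀ x ∈ S k, M ≤ x → x ∈ B) : hasDensity B δ := by
  change Tendsto (fun n : ℕ => cnt B n / n) atTop (nhds δ)
  rw [tendsto_order]
  constructor
  · intro a ha
    obtain ⟨k, hk⟩ := (hd.eventually (lt_mem_nhds ha)).exists
    obtain ⟨M, hM⟩ := h2 k
    have ht : Tendsto (fun n : ℕ => cnt (S k) n / n - (M : ℝ) / n) atTop (nhds (d k - 0)) :=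
      Tendsto.sub (hS k) (tendsto_const_div_atTop_nhds_zero_nat _)
    rw [sub_zero] at ht
    filter_upwards [ht.eventually (lt_mem_nhds hk)] with n hn
    refine hn.trans_le ?_
    rw [← sub_div]
    refine div_le_div_of_nonneg_right ?_ (Nat.cast_nonneg n)
    linarith [cnt_tail (n := n) hM]
  · intro b hb
    obtain ⟨K, hK⟩ := exists_nat_one_div_lt (sub_pos.2 hb)
    filter_upwards [eventually_ge_atTop (N K)] with n hn
    have hex : ∃ j, n < N (j + 1) := ⟨n, Nat.lt_of_lt_of_le (Nat.lt_succ_self n) (hN.id_le (n + 1))⟩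
    classical
    set k := Nat.find hex with hkdef
    have hk : n < N (k + 1) := Nat.find_spec hex
    have hKk : K ≤ k := by
      by_contra hc
      have : N (k + 1) ≤ N K := hN.monotone (by omega)
      omega
    have hk2 : N k ≤ n := by
      rcases Nat.eq_zero_or_pos k with h0 | h0
      · have : K = k := by omega
        rw [← this]; exact hn
      · have := Nat.find_min hex (m := k - 1) (by omega)
        rw [Nat.sub_add_cancel h0] at this
        omega
    have e1 : cnt B n / n ≤ cnt (S k) n / n :=
      div_le_div_of_nonneg_right (cnt_mono (fun x hx => h1 k x hx.1 (lt_of_le_of_lt hx.2.2 hk)))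
        (Nat.cast_nonneg n)
    have e2 := hup k n hk2
    have e3 : 1 / ((k : ℝ) + 1) ≤ 1 / ((K : ℝ) + 1) := by
      apply one_div_le_one_div_of_le (by positivity)
      have : (K : ℝ) ≤ k := by exact_mod_cast hKk
      linarith
    linarith [hle k]

def Per (m : ℕ) (R : Finset (ZMod m)) : Set ℕ := {n | (n : ZMod m) ∈ R}

lemma per_single (m : ℕ) [NeZero m] (v : ZMod m) : hasDensity {n : ℕ | (n : ZMod m) = v} (1 / m) := by
  have hm : 0 < m := Nat.pos_of_neZero m
  have key : ∀ n : ℕ, ((n : ℝ) / m - 1 ≤ cnt {n : ℕ | (n : ZMod m) = v} n) ∧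
      cnt {n : ℕ | (n : ZMod m) = v} n ≤ (n : ℝ) / m + 1 := by
    intro n
    have h0 : {n : ℕ | (n : ZMod m) = v} ∩ Set.Icc 1 n
        = ((Finset.Ioc 0 n).filter (fun x => x ≡ v.val [MOD m]) : Finset ℕ) := by
      ext x
      simp only [Set.mem_inter_iff, Set.mem_ofPred_eq, Set.mem_Icc, Finset.coe_filter, Finset.mem_Ioc]
      rw [← ZMod.natCast_eq_natCast_iff, ZMod.natCast_zmod_val]
      constructor
      · rintro ⟨a, b, c⟩; exact ⟨⟨by omega, c⟩, a⟩
      · rintro ⟨⟨b, c⟩, a⟩; exact ⟨a, by omega, c⟩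
    unfold cnt
    rw [h0, Set.ncard_coe_finset]
    have h1 := Nat.Ioc_filter_modEq_card 0 n hm v.val
    have h2 : (((Finset.Ioc 0 n).filter (fun x => x ≡ v.val [MOD m])).card : ℝ) =
      ((max (⌊((n:ℚ) - (v.val:ℚ)) / m⌋ - ⌊(((0:ℕ):ℚ) - (v.val:ℚ)) / m⌋) 0 : ℤ) : ℝ) := by
      rw [← h1]; simp
    rw [h2]
    have a1 := Int.floor_le (((n:ℚ) - (v.val:ℚ)) / m)
    have a2 := Int.lt_floor_add_one (((n:ℚ) - (v.val:ℚ)) / m)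
    have a3 := Int.floor_le ((((0:ℕ):ℚ) - (v.val:ℚ)) / m)
    have a4 := Int.lt_floor_add_one ((((0:ℕ):ℚ) - (v.val:ℚ)) / m)
    set f1 := ⌊((n:ℚ) - (v.val:ℚ)) / m⌋
    set f2 := ⌊(((0:ℕ):ℚ) - (v.val:ℚ)) / m⌋
    rw [sub_div] at a1 a2 a3 a4
    have c0 : (0:ℚ) ≤ (n:ℚ) / m := by positivity
    simp only [Nat.cast_zero, zero_div] at a3 a4
    have b1 : ((n:ℚ) / m - 1 : ℚ) ≤ ((max (f1 - f2) 0 : ℤ) : ℚ) := by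
      push_cast; exact le_max_of_le_left (by linarith)
    have b2 : ((max (f1 - f2) 0 : ℤ) : ℚ) ≤ ((n:ℚ) / m + 1 : ℚ) := by
      push_cast; exact max_le (by linarith) (by linarith)
    have b1' := (Rat.cast_le (K := ℝ)).2 b1
    have b2' := (Rat.cast_le (K := ℝ)).2 b2
    push_cast at b1' b2' ⊢
    exact ⟨b1', b2'⟩
  have l1 : Tendsto (fun n : ℕ => (1 / m : ℝ) - 1 / n) atTop (nhds (1 / m - 0)) :=
    tendsto_const_nhds.sub (tendsto_const_div_atTop_nhds_zero_nat _)
  have l2 : Tendsto (fun n : ℕ => (1 / m : ℝ) + 1 / n) atTop (nhds (1 / m + 0)) :=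
    tendsto_const_nhds.add (tendsto_const_div_atTop_nhds_zero_nat _)
  rw [sub_zero] at l1
  rw [add_zero] at l2
  refine tendsto_of_tendsto_of_tendsto_of_le_of_le' l1 l2 ?_ ?_
  · filter_upwards [eventually_gt_atTop 0] with n hn
    have hn' : (0:ℝ) < n := by exact_mod_cast hn
    rw [le_div_iff₀ hn']
    have := (key n).1
    unfold cnt at this
    refine le_trans (le_of_eq ?_) this
    field_simp
  · filter_upwards [eventually_gt_atTop 0] with n hn
    have hn' : (0:ℝ) < n := by exact_mod_cast hn
    rw [div_le_iff₀ hn']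
    have := (key n).2
    unfold cnt at this
    refine le_trans this (le_of_eq ?_)
    field_simp

lemma per_dens (m : ℕ) [NeZero m] (R : Finset (ZMod m)) : hasDensity (Per m R) (R.card / m) := by
  classical
  induction R using Finset.induction_on with
  | empty =>
    unfold hasDensity Per
    simp
  | insert a s ha ih =>
    have h : ∀ n : ℕ, ((Per m (insert a s) ∩ Set.Icc 1 n).ncard : ℝ) / n =
       (({n : ℕ | (n : ZMod m) = a} ∩ Set.Icc 1 n).ncard : ℝ) / n +
        ((Per m s ∩ Set.Icc 1 n).ncard : ℝ) / n := by
      intro n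
      rw [← add_div]
      congr 1
      rw [← Nat.cast_add, ← Set.ncard_union_eq]
      · congr 2
        ext x
        simp [Per]
        tauto
      · rw [Set.disjoint_left]
        rintro x ⟨hx, -⟩ ⟨hx2, -⟩
        simp only [Set.mem_ofPred_eq, Per] at hx hx2
        exact ha (hx ▸ hx2)
    unfold hasDensity
    simp_rw [h]
    rw [Finset.card_insert_of_notMem ha]
    have := Tendsto.add (per_single m a) ih
    convert this using 2
    push_cast; ring

open Classical in
noncomputable def V (m : ℕ) [NeZero m] : Finset (ZMod m) :=
  Finset.univ.filter (fun v => ∃ p : ℕ, p.Prime ∧ (p : ZMod m) = v)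

lemma mem_V {m : ℕ} [NeZero m] {v : ZMod m} : v ∈ V m ↔ ∃ p : ℕ, p.Prime ∧ (p : ZMod m) = v := by
  simp [V]

lemma step {α : ℝ} (hα : α ≤ 1) (m m' : ℕ) [NeZero m] [NeZero m'] (hdvd : m ∣ m')
    (R : Finset (ZMod m)) (hR : ((R + V m).card : ℝ) / m ≤ α) :
    ∃ R' : Finset (ZMod m'), Per m R ⊆ Per m' R' ∧ ((R' + V m').card : ℝ) / m' ≤ α ∧
      α - ((V m').card : ℝ) / m' ≤ ((R' + V m').card : ℝ) / m' := by
  classical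
  have hm' : (0:ℝ) < m' := by exact_mod_cast Nat.pos_of_neZero m'
  set R0 : Finset (ZMod m') := Finset.univ.filter (fun r => ZMod.castHom hdvd (ZMod m) r ∈ R) with hR0
  have h0 : ((R0 + V m').card : ℝ) / m' ≤ α := by
    refine le_trans (dens_mono (per_dens m' (R0 + V m')) (per_dens m (R + V m)) ?_) hR
    intro n hn
    simp only [Per, Set.mem_ofPred_eq, Finset.mem_add] at hn ⊢
    obtain ⟨r, hr, v, hv, hrv⟩ := hn
    obtain ⟨p, hp, rfl⟩ := mem_V.1 hv
    refine ⟨ZMod.castHom hdvd (ZMod m) r, (Finset.mem_filter.1 hr).2, (p : ZMod m),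
      mem_V.2 ⟨p, hp, rfl⟩, ?_⟩
    have := congrArg (ZMod.castHom hdvd (ZMod m)) hrv
    rw [map_add, map_natCast, map_natCast] at this
    exact this
  obtain ⟨R', hle, hmax⟩ := (Set.toFinite {T : Finset (ZMod m') | ((T + V m').card : ℝ) / m' ≤ α}).exists_le_maximal h0
  refine ⟨R', ?_, hmax.1, ?_⟩
  · intro n hn
    apply hle
    rw [hR0, Finset.mem_filter]
    refine ⟨Finset.mem_univ _, ?_⟩
    rw [map_natCast]
    exact hn
  · by_cases hu : R' = Finset.univ
    · have : R' + V m' = Finset.univ := by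
        rw [hu]
        have hne : (V m').Nonempty := ⟨_, mem_V.2 ⟨2, Nat.prime_two, rfl⟩⟩
        obtain ⟨v, hv⟩ := hne
        ext x
        simp only [Finset.mem_univ, iff_true, Finset.mem_add]
        exact ⟨x - v, trivial, v, hv, by ring⟩
      rw [this, Finset.card_univ, ZMod.card, div_self hm'.ne']
      have : (0:ℝ) ≤ ((V m').card : ℝ) / m' := by positivity
      linarith
    · obtain ⟨r, hr⟩ : ∃ r, r ∉ R' := by
        by_contra hc
        push Not at hc
        exact hu (Finset.eq_univ_iff_forall.2 hc)
      have hn : ¬ (((insert r R' + V m').card : ℝ) / m' ≤ α) := by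
        intro hc
        exact hr (hmax.2 hc (Finset.subset_insert r R') (Finset.mem_insert_self r R'))
      have hc : (insert r R' + V m').card ≤ (V m').card + (R' + V m').card := by
        rw [Finset.insert_eq, Finset.union_add]
        refine (Finset.card_union_le _ _).trans ?_
        rw [Finset.card_singleton_add]
      have hc' : ((insert r R' + V m').card : ℝ) / m' ≤ ((V m').card : ℝ) / m' + ((R' + V m').card : ℝ) / m' := by
        rw [← add_div]
        exact div_le_div_of_nonneg_right (by exact_mod_cast hc) hm'.le
      linarith

instance (k : ℕ) : NeZero (k.factorial) := ⟨k.factorial_ne_zero⟩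

lemma totient_lim : Tendsto (fun k : ℕ => ((k.factorial).totient : ℝ) / k.factorial) atTop (nhds 0) := by
  have h1 := (not_summable_iff_tendsto_nat_atTop_of_nonneg (fun n => by
    apply Set.indicator_nonneg; intro x _; positivity)).1 not_summable_one_div_on_primes
  have h2 := (Real.tendsto_exp_neg_atTop_nhds_zero.comp h1).comp (tendsto_add_atTop_nat 1)
  refine squeeze_zero (fun k => by positivity) (fun k => ?_) h2
  have hpos : (0:ℝ) < k.factorial := by exact_mod_cast k.factorial_pos
  have e := congrArg (fun q : ℚ => (q : ℝ)) (Nat.totient_eq_mul_prod_factors k.factorial)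
  push_cast at e
  rw [e, mul_div_cancel_left₀ _ hpos.ne']
  have hpf : (k.factorial).primeFactors = (Finset.range (k + 1)).filter Nat.Prime := by
    ext p
    simp only [Nat.mem_primeFactors, Finset.mem_filter, Finset.mem_range]
    constructor
    · rintro ⟨hp, hd, -⟩
      exact ⟨Nat.lt_succ_of_le (hp.dvd_factorial.1 hd), hp⟩
    · rintro ⟨hl, hp⟩
      exact ⟨hp, hp.dvd_factorial.2 (Nat.le_of_lt_succ hl), k.factorial_ne_zero⟩
  have hs : ∑ i ∈ Finset.range (k + 1), Set.indicator {p : ℕ | p.Prime} (fun n : ℕ => (1 : ℝ) / n) i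
      = ∑ p ∈ (Finset.range (k + 1)).filter Nat.Prime, (1 : ℝ) / p := by
    rw [Finset.sum_filter]
    refine Finset.sum_congr rfl fun i _ => ?_
    simp [Set.indicator_apply]
  simp only [Function.comp]
  rw [hs, ← Finset.sum_neg_distrib, Real.exp_sum, hpf]
  refine Finset.prod_le_prod (fun p hp => ?_) (fun p hp => ?_)
  · have hp2 : (1:ℝ) ≤ p := by exact_mod_cast (Finset.mem_filter.1 hp).2.one_le
    have := inv_le_one_of_one_le₀ hp2
    linarith
  · have := Real.add_one_le_exp (-(1 / (p:ℝ)))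
    rw [one_div] at this ⊢
    linarith

lemma V_lim : Tendsto (fun k : ℕ => ((V k.factorial).card : ℝ) / k.factorial) atTop (nhds 0) := by
  have h2 : Tendsto (fun k : ℕ => ((k.factorial).totient : ℝ) / k.factorial + (2:ℝ) ^ k / k.factorial)
      atTop (nhds (0 + 0)) := totient_lim.add (FloorSemiring.tendsto_pow_div_factorial_atTop 2)
  rw [add_zero] at h2
  refine squeeze_zero (fun k => by positivity) (fun k => ?_) h2
  rw [← add_div]
  refine div_le_div_of_nonneg_right ?_ (Nat.cast_nonneg _)
  classical
  set m := k.factorial with hm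
  have hsub : V m ⊆ ((Finset.range m).filter (fun x => m.Coprime x)).image (fun x : ℕ => (x : ZMod m)) ∪
      (Finset.range (k + 1)).image (fun x : ℕ => (x : ZMod m)) := by
    intro v hv
    obtain ⟨p, hp, rfl⟩ := mem_V.1 hv
    rw [Finset.mem_union, Finset.mem_image, Finset.mem_image]
    by_cases hpk : p ≤ k
    · right; exact ⟨p, Finset.mem_range.2 (by omega), rfl⟩
    · left
      refine ⟨p % m, ?_, by simp⟩
      rw [Finset.mem_filter, Finset.mem_range]
      refine ⟨Nat.mod_lt _ (Nat.factorial_pos k), ?_⟩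
      have : Nat.Coprime p m := (Nat.Prime.coprime_iff_not_dvd hp).2 (by
        rw [hm, hp.dvd_factorial]; exact hpk)
      rw [Nat.coprime_comm]
      unfold Nat.Coprime at this ⊢
      rw [← this, Nat.gcd_comm p m, Nat.gcd_rec m p]
  have hc : (V m).card ≤ m.totient + (k + 1) := by
    refine (Finset.card_le_card hsub).trans ((Finset.card_union_le _ _).trans ?_)
    refine add_le_add (Finset.card_image_le.trans (le_of_eq ?_)) (Finset.card_image_le.trans (by simp))
    rfl
  have hk : k + 1 ≤ 2 ^ k := Nat.lt_two_pow_self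
  exact_mod_cast hc.trans (Nat.add_le_add_left hk _)

end Aux17

theorem stmt17 (α : ℝ) (hα : α ∈ Set.Icc (0 : ℝ) 1) :
    ∃ A : Set ℕ, (∃ β : ℝ, hasDensity A β) ∧
      hasDensity (sumset A {p : ℕ | p.Prime}) α := by
  classical
  obtain ⟨hα0, hα1⟩ := hα
  let Good : (k : ℕ) → Finset (ZMod k.factorial) → Prop := fun k R =>
    ((R + Aux17.V k.factorial).card : ℝ) / k.factorial ≤ α ∧
      α - ((Aux17.V k.factorial).card : ℝ) / k.factorial ≤
        ((R + Aux17.V k.factorial).card : ℝ) / k.factorial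
  have h0 : ∃ R, Good 0 R := by
    obtain ⟨R, -, h⟩ := Aux17.step hα1 (Nat.factorial 0) (Nat.factorial 0) dvd_rfl ∅ (by
      rw [Finset.empty_add, Finset.card_empty, Nat.cast_zero, zero_div]; exact hα0)
    exact ⟨R, h⟩
  have hs : ∀ k (R : {R // Good k R}), ∃ R' : {R // Good (k + 1) R},
      Aux17.Per k.factorial R.1 ⊆ Aux17.Per (k + 1).factorial R'.1 := by
    rintro k ⟨R, hR⟩
    obtain ⟨R', h1, h2⟩ := Aux17.step hα1 k.factorial (k + 1).factorial
      (Nat.factorial_dvd_factorial (Nat.le_succ k)) R hR.1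
    exact ⟨⟨R', h2⟩, h1⟩
  choose nxt hnxt using hs
  let R : (k : ℕ) → {R // Good k R} := fun k =>
    Nat.rec (motive := fun k => {R // Good k R}) ⟨h0.choose, h0.choose_spec⟩ (fun k r => nxt k r) k
  set A : ℕ → Set ℕ := fun k => Aux17.Per k.factorial (R k).1 with hA
  have hAmono : Monotone A := monotone_nat_of_le_succ fun k => hnxt k (R k)
  set S : ℕ → Set ℕ := fun k => Aux17.Per k.factorial ((R k).1 + Aux17.V k.factorial) with hS
  set a : ℕ → ℝ := fun k => ((R k).1.card : ℝ) / k.factorial with ha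
  set d : ℕ → ℝ := fun k => (((R k).1 + Aux17.V k.factorial).card : ℝ) / k.factorial with hd
  have hAd : ∀ k, hasDensity (A k) (a k) := fun k => Aux17.per_dens _ _
  have hSd : ∀ k, hasDensity (S k) (d k) := fun k => Aux17.per_dens _ _
  have hamono : Monotone a := fun i j hij => Aux17.dens_mono (hAd i) (hAd j) (hAmono hij)
  have habdd : BddAbove (Set.range a) := ⟨1, by
    rintro _ ⟨k, rfl⟩; exact Aux17.dens_le_one (hAd k)⟩
  have halim := tendsto_atTop_ciSup hamono habdd
  have hdle : ∀ k, d k ≤ α := fun k => (R k).2.1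
  have hdlim : Tendsto d atTop (nhds α) := by
    have hl : Tendsto (fun k : ℕ => α - ((Aux17.V k.factorial).card : ℝ) / k.factorial) atTop
        (nhds (α - 0)) := tendsto_const_nhds.sub Aux17.V_lim
    rw [sub_zero] at hl
    exact tendsto_of_tendsto_of_tendsto_of_le_of_le hl tendsto_const_nhds
      (fun k => (R k).2.2) hdle
  have hev : ∀ k, ∃ N0, ∀ n ≥ N0, Aux17.cnt (A k) n / n ≤ a k + 1 / ((k : ℝ) + 1) ∧
      Aux17.cnt (S k) n / n ≤ d k + 1 / ((k : ℝ) + 1) := by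
    intro k
    have hp : (0:ℝ) < 1 / ((k : ℝ) + 1) := by positivity
    have e1 := (hAd k).eventually (ge_mem_nhds (lt_add_of_pos_right (a k) hp))
    have e2 := (hSd k).eventually (ge_mem_nhds (lt_add_of_pos_right (d k) hp))
    exact eventually_atTop.1 (e1.and e2)
  choose N0 hN0 using hev
  set N : ℕ → ℕ := fun k => k + ∑ i ∈ Finset.range (k + 1), N0 i with hN
  have hNmono : StrictMono N := strictMono_nat_of_lt_succ fun k => by
    simp only [hN]
    rw [Finset.sum_range_succ _ (k + 1)]
    omega
  have hNge : ∀ k, N0 k ≤ N k := fun k => by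
    simp only [hN]
    rw [Finset.sum_range_succ]
    omega
  set B : Set ℕ := {x | ∃ k, x ∈ A k ∧ N k ≤ x} with hB
  have hBA : ∀ k x, x ∈ B → x < N (k + 1) → x ∈ A k := by
    rintro k x ⟨j, hj, hjx⟩ hx
    have : j < k + 1 := hNmono.lt_iff_lt.1 (lt_of_le_of_lt hjx hx)
    exact hAmono (Nat.le_of_lt_succ this) hj
  refine ⟨B, ⟨⨆ i, a i, ?_⟩, ?_⟩
  · exact Aux17.dens_limit A B a _ N hNmono halim (fun k => le_ciSup habdd k) hAd
      (fun k n hn => (hN0 k n ((hNge k).trans hn)).1) hBA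
      (fun k => ⟨N k, fun x hx hxN => ⟨k, hx, hxN⟩⟩)
  · refine Aux17.dens_limit S _ d _ N hNmono hdlim hdle hSd
      (fun k n hn => (hN0 k n ((hNge k).trans hn)).2) ?_ ?_
    · rintro k x ⟨b, hb, p, hp, rfl⟩ hx
      have hbA := hBA k b hb (by omega)
      change ((b + p : ℕ) : ZMod k.factorial) ∈ (R k).1 + Aux17.V k.factorial
      rw [Nat.cast_add]
      exact Finset.add_mem_add hbA (Aux17.mem_V.2 ⟨p, hp, rfl⟩)
    · intro k
      have hq : ∀ v : ZMod k.factorial, ∃ p : ℕ, v ∈ Aux17.V k.factorial →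
          p.Prime ∧ (p : ZMod k.factorial) = v := by
        intro v
        by_cases hv : v ∈ Aux17.V k.factorial
        · obtain ⟨p, hp⟩ := Aux17.mem_V.1 hv
          exact ⟨p, fun _ => hp⟩
        · exact ⟨0, fun h => absurd h hv⟩
      choose q hq using hq
      refine ⟨N k + ∑ v, q v, fun x hx hxM => ?_⟩
      obtain ⟨r, hr, v, hv, hrv⟩ := Finset.mem_add.1 (show (x : ZMod k.factorial) ∈ _ from hx)
      have hqv : q v ≤ ∑ v, q v := Finset.single_le_sum (fun _ _ => Nat.zero_le _) (Finset.mem_univ v)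
      refine ⟨x - q v, ⟨k, ?_, by omega⟩, q v, (hq v hv).1, by omega⟩
      change ((x - q v : ℕ) : ZMod k.factorial) ∈ (R k).1
      rw [Nat.cast_sub (by omega), (hq v hv).2, ← hrv, add_sub_cancel_right]
      exact hr
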